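/- arXiv:2512.20413 — 6 statements merged into one kernel-verified Lean document; each statement's English description precedes it below -/
import Mathlib

section
/- There exists an injective group homomorphism β : SL(2, 𝔽₃) → SL(2, ℤ₃) such that π ∘ β is the identity map on SL(2, 𝔽₃), where π : SL(2, ℤ₃) → SL(2, 𝔽₃) is the reduction-mod-3 homomorphism. -/
open scoped Quaternion

/-- The matrix `x + y i + z j + w k` for `i = !![0, -1; 1, 0]`, `j = !![1, b; b, -1]`, `k = i * j`.
When `b ^ 2 = -2` this is a representation of the Hamilton quaternions. -/
def quaternionMatrix {R : Type*} [CommRing R] (b : R) (q : ℍ[ℤ]) : Matrix (Fin 2) (Fin 2) R :=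
  !![q.re + q.imJ - b * q.imK, -q.imI + b * q.imJ + q.imK;
    q.imI + b * q.imJ + q.imK, q.re - q.imJ + b * q.imK]

theorem quaternionMatrix_mul {R : Type*} [CommRing R] {b : R} (hb : b ^ 2 = -2) (q r : ℍ[ℤ]) :
    quaternionMatrix b (q * r) = quaternionMatrix b q * quaternionMatrix b r := by
  ext i j
  fin_cases i <;> fin_cases j <;>
    simp only [quaternionMatrix, Matrix.mul_apply, Fin.sum_univ_two, Quaternion.re_mul,
      Quaternion.imI_mul, Quaternion.imJ_mul, Quaternion.imK_mul, Fin.zero_eta, Fin.mk_one,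
      Matrix.of_apply, Matrix.cons_val_zero, Matrix.cons_val_one, Matrix.cons_val_fin_one] <;>
    push_cast
  · linear_combination (-(q.imJ * r.imJ : R) - q.imK * r.imK) * hb
  · linear_combination ((q.imK * r.imJ : R) - q.imJ * r.imK) * hb
  · linear_combination ((q.imJ * r.imK : R) - q.imK * r.imJ) * hb
  · linear_combination (-(q.imJ * r.imJ : R) - q.imK * r.imK) * hb

theorem det_quaternionMatrix {R : Type*} [CommRing R] {b : R} (hb : b ^ 2 = -2) (q : ℍ[ℤ]) :
    (quaternionMatrix b q).det =
      ((q.re ^ 2 + q.imI ^ 2 + q.imJ ^ 2 + q.imK ^ 2 : ℤ) : R) := by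
  simp only [quaternionMatrix, Matrix.det_fin_two_of]
  push_cast
  linear_combination (-(q.imJ ^ 2 : R) - q.imK ^ 2) * hb

/-- The representative of an element of `𝔽₃` in `{-1, 0, 1}`. -/
def signLift (x : ZMod 3) : ℤ :=
  if x = 0 then 0 else if x = 1 then 1 else -1

/-- Twice the Hurwitz unit whose reduction modulo 3 is the quaternion with coordinates
`x, y, z, w` over `𝔽₃`, when the latter has norm 1. -/
def twiceHurwitzUnit (x y z w : ZMod 3) : ℍ[ℤ] :=
  let c : ℤ := if x * y * z * w = 0 then 2 else -1
  ⟨c * signLift x, c * signLift y, c * signLift z, c * signLift w⟩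

/-- Twice the Hurwitz unit reducing to the matrix `!![p, q; r, s]` in `SL(2, 𝔽₃)`. -/
def twiceHurwitzLift (p q r s : ZMod 3) : ℍ[ℤ] :=
  twiceHurwitzUnit (-(p + s)) (q - r) (p - s + q + r) (s - p + q + r)

theorem twiceHurwitzLift_mul : ∀ p q r s : ZMod 3, p * s - q * r = 1 →
    ∀ p' q' r' s' : ZMod 3, p' * s' - q' * r' = 1 →
    let A := twiceHurwitzLift p q r s
    let B := twiceHurwitzLift p' q' r' s'
    let C := twiceHurwitzLift (p * p' + q * r') (p * q' + q * s')
      (r * p' + s * r') (r * q' + s * s')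
    2 * C.re = A.re * B.re - A.imI * B.imI - A.imJ * B.imJ - A.imK * B.imK ∧
    2 * C.imI = A.re * B.imI + A.imI * B.re + A.imJ * B.imK - A.imK * B.imJ ∧
    2 * C.imJ = A.re * B.imJ - A.imI * B.imK + A.imJ * B.re + A.imK * B.imI ∧
    2 * C.imK = A.re * B.imK + A.imI * B.imJ - A.imJ * B.imI + A.imK * B.re := by
  decide +kernel

theorem twiceHurwitzLift_norm : ∀ p q r s : ZMod 3, p * s - q * r = 1 →
    let A := twiceHurwitzLift p q r s
    A.re ^ 2 + A.imI ^ 2 + A.imJ ^ 2 + A.imK ^ 2 = 4 := by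
  decide +kernel

theorem quaternionMatrix_twiceHurwitzLift : ∀ p q r s : ZMod 3, p * s - q * r = 1 →
    2 • quaternionMatrix (1 : ZMod 3) (twiceHurwitzLift p q r s) = !![p, q; r, s] := by
  decide +kernel

/-- The lift of a matrix over `𝔽₃` to a ring in which `h` is an inverse of `2` and `b` is a
square root of `-2`. -/
def hurwitzMatrix {R : Type*} [CommRing R] (h b : R) (A : Matrix (Fin 2) (Fin 2) (ZMod 3)) :
    Matrix (Fin 2) (Fin 2) R :=
  h • quaternionMatrix b (twiceHurwitzLift (A 0 0) (A 0 1) (A 1 0) (A 1 1))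

theorem hurwitzMatrix_mul {R : Type*} [CommRing R] {h b : R} (hh : 2 * h = 1) (hb : b ^ 2 = -2)
    {A B : Matrix (Fin 2) (Fin 2) (ZMod 3)} (hA : A.det = 1) (hB : B.det = 1) :
    hurwitzMatrix h b (A * B) = hurwitzMatrix h b A * hurwitzMatrix h b B := by
  rw [Matrix.det_fin_two] at hA hB
  obtain ⟨h₀, h₁, h₂, h₃⟩ := twiceHurwitzLift_mul _ _ _ _ hA _ _ _ _ hB
  simp only [hurwitzMatrix, Matrix.smul_mul, Matrix.mul_smul, ← quaternionMatrix_mul hb]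
  simp only [Matrix.mul_apply, Fin.sum_univ_two]
  congr 1
  ext i j
  fin_cases i <;> fin_cases j <;>
    simp only [quaternionMatrix, Matrix.smul_apply, smul_eq_mul, Quaternion.re_mul,
      Quaternion.imI_mul, Quaternion.imJ_mul, Quaternion.imK_mul, Fin.zero_eta, Fin.mk_one,
      Matrix.of_apply, Matrix.cons_val_zero, Matrix.cons_val_one, Matrix.cons_val_fin_one,
      ← h₀, ← h₁, ← h₂, ← h₃, Int.cast_mul, Int.cast_ofNat]
  all_goals
    generalize twiceHurwitzLift _ _ _ _ = C
  · linear_combination -(C.re + C.imJ - b * C.imK) * hh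
  · linear_combination -(-C.imI + b * C.imJ + C.imK) * hh
  · linear_combination -(C.imI + b * C.imJ + C.imK) * hh
  · linear_combination -(C.re - C.imJ + b * C.imK) * hh

theorem det_hurwitzMatrix {R : Type*} [CommRing R] {h b : R} (hh : 2 * h = 1) (hb : b ^ 2 = -2)
    {A : Matrix (Fin 2) (Fin 2) (ZMod 3)} (hA : A.det = 1) : (hurwitzMatrix h b A).det = 1 := by
  rw [Matrix.det_fin_two] at hA
  rw [hurwitzMatrix, Matrix.det_smul, det_quaternionMatrix hb, twiceHurwitzLift_norm _ _ _ _ hA]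
  simp only [Fintype.card_fin, Int.cast_ofNat]
  linear_combination (2 * h + 1) * hh

theorem hurwitzMatrix_one {R : Type*} [CommRing R] {h b : R} (hh : 2 * h = 1) :
    hurwitzMatrix h b 1 = 1 := by
  have key : twiceHurwitzLift 1 0 0 1 = ⟨2, 0, 0, 0⟩ := by
    ext <;> decide
  ext i j
  fin_cases i <;> fin_cases j <;>
    simp [hurwitzMatrix, key, quaternionMatrix, mul_comm h, hh]

theorem map_hurwitzMatrix {R : Type*} [CommRing R] {h b : R} (hh : 2 * h = 1) (f : R →+* ZMod 3)
    (hfb : f b = 1) {A : Matrix (Fin 2) (Fin 2) (ZMod 3)} (hA : A.det = 1) :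
    (hurwitzMatrix h b A).map f = A := by
  have hfh : f h = 2 := by
    have : 2 * f h = 1 := by rw [← map_ofNat f 2, ← map_mul, hh, map_one]
    generalize f h = x at this
    revert x
    decide
  rw [Matrix.det_fin_two] at hA
  conv_rhs => rw [A.eta_fin_two, ← quaternionMatrix_twiceHurwitzLift _ _ _ _ hA]
  ext i j
  fin_cases i <;> fin_cases j <;>
    simp [hurwitzMatrix, quaternionMatrix, hfh, hfb] <;>
    ring

/-- The lift `hurwitzMatrix` as a homomorphism of special linear groups. -/
def hurwitzHom {R : Type*} [CommRing R] (h b : R) (hh : 2 * h = 1) (hb : b ^ 2 = -2) :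
    Matrix.SpecialLinearGroup (Fin 2) (ZMod 3) →* Matrix.SpecialLinearGroup (Fin 2) R where
  toFun A := ⟨hurwitzMatrix h b A, det_hurwitzMatrix hh hb A.2⟩
  map_one' := Subtype.ext (hurwitzMatrix_one hh)
  map_mul' A B := Subtype.ext (hurwitzMatrix_mul hh hb A.2 B.2)

theorem PadicInt.exists_two_mul_eq_one : ∃ h : ℤ_[3], 2 * h = 1 := by
  have : IsUnit ((2 : ℕ) : ℤ_[3]) := by
    rw [PadicInt.isUnit_iff, PadicInt.norm_natCast_eq_one_iff]
    decide
  exact_mod_cast isUnit_iff_exists_inv.mp this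

theorem PadicInt.exists_sq_eq_neg_two :
    ∃ b : ℤ_[3], b ^ 2 = -2 ∧ PadicInt.toZMod b = 1 := by
  have h₂ : ‖(2 : ℤ_[3])‖ = 1 := by
    simpa using (PadicInt.norm_natCast_eq_one_iff (p := 3) (n := 2)).mpr (by decide)
  have h₃ : ‖(3 : ℤ_[3])‖ < 1 := by
    simpa using (PadicInt.norm_natCast_lt_one_iff (p := 3) (n := 3)).mpr (by decide)
  obtain ⟨z, hz, -⟩ := hensels_lemma (p := 3) (F := (Polynomial.X ^ 2 + 2 : Polynomial ℤ_[3]))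
    (a := 1) (by
      norm_num [Polynomial.derivative_add, h₂]
      simpa using h₃)
  have hz' : z ^ 2 = -2 := by
    simp only [map_add, map_pow, Polynomial.aeval_X, map_ofNat] at hz
    linear_combination hz
  have hmod : PadicInt.toZMod z ^ 2 = -2 := by
    rw [← map_pow, hz', map_neg, map_ofNat]
  have hcases : ∀ x : ZMod 3, x ^ 2 = -2 → x = 1 ∨ -x = 1 := by decide
  rcases hcases _ hmod with h | h
  · exact ⟨z, hz', h⟩
  · exact ⟨-z, by rw [neg_sq, hz'], by rw [map_neg, h]⟩

theorem stmt_7 :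
    ∃ β : Matrix.SpecialLinearGroup (Fin 2) (ZMod 3) →*
        Matrix.SpecialLinearGroup (Fin 2) ℤ_[3],
      Function.Injective β ∧
      (Matrix.SpecialLinearGroup.map (PadicInt.toZMod (p := 3))).comp β =
        MonoidHom.id (Matrix.SpecialLinearGroup (Fin 2) (ZMod 3)) := by
  obtain ⟨h, hh⟩ := PadicInt.exists_two_mul_eq_one
  obtain ⟨b, hb, hb₁⟩ := PadicInt.exists_sq_eq_neg_two
  have hcomp : (Matrix.SpecialLinearGroup.map (PadicInt.toZMod (p := 3))).comp
      (hurwitzHom h b hh hb) = MonoidHom.id _ :=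
    MonoidHom.ext fun A => Subtype.ext (map_hurwitzMatrix hh _ hb₁ A.2)
  exact ⟨hurwitzHom h b hh hb,
    Function.LeftInverse.injective (g := Matrix.SpecialLinearGroup.map PadicInt.toZMod) fun A =>
      DFunLike.congr_fun hcomp A, hcomp⟩
end

section
/- There exists an injective group homomorphism β : GL(2, 𝔽₃) → GL(2, ℤ₃) such that π ∘ β is the identity map on GL(2, 𝔽₃), where π : GL(2, ℤ₃) → GL(2, 𝔽₃) is the reduction-mod-3 homomorphism. -/
theorem PadicInt.norm_two_of_three : ‖(2 : ℤ_[3])‖ = 1 := by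
  exact_mod_cast (PadicInt.norm_natCast_eq_one_iff (p := 3) (n := 2)).2 (by decide)

open Polynomial in
/-- `-2` has a square root in `ℤ_[3]` reducing to `1`. -/
theorem exists_sqrt_neg_two_padicInt_three :
    ∃ s : ℤ_[3], s * s = -2 ∧ PadicInt.toZMod (p := 3) s = 1 := by
  have h2 := PadicInt.norm_two_of_three
  have h3 : ‖(3 : ℤ_[3])‖ < 1 := by
    exact_mod_cast PadicInt.norm_natCast_lt_one_iff (p := 3) (n := 3) |>.2 dvd_rfl
  have hF : (X ^ 2 + 2 : ℤ_[3][X]).aeval (1 : ℤ_[3]) = 3 := by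
    norm_num
  have hF' : (derivative (X ^ 2 + 2 : ℤ_[3][X])).aeval (1 : ℤ_[3]) = 2 := by
    simp [one_add_one_eq_two]
  obtain ⟨s, hs, hs1, -⟩ := hensels_lemma (p := 3) (R := ℤ_[3]) (F := X ^ 2 + 2) (a := 1)
    (by rw [hF, hF', h2]; simpa using h3)
  refine ⟨s, ?_, ?_⟩
  · have : s ^ 2 + 2 = 0 := by simpa using hs
    linear_combination this
  · rw [hF', h2] at hs1
    have hk : s - 1 ∈ RingHom.ker (PadicInt.toZMod (p := 3)) := by
      rw [PadicInt.ker_toZMod, IsLocalRing.mem_maximalIdeal, PadicInt.mem_nonunits]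
      exact hs1
    rw [RingHom.mem_ker, map_sub, map_one] at hk
    exact sub_eq_zero.1 hk

/-- The entry of twice the lift of an invertible matrix over `ZMod 3` at a position with entry `a`,
where `b` is the other entry of its row, `c` the other entry of its column, and `d` the opposite
entry. -/
def liftEntry (a b c d : ZMod 3) : ℤ√(-2) :=
  if a = 0 then (b * c * d).valMinAbs • ⟨-1, 1⟩
  else a.valMinAbs •
    if d = 0 then ⟨1, 1⟩
    else if b = 0 then (if c = 0 then ⟨2, 0⟩ else ⟨-1, 0⟩)
    else if c = 0 then ⟨-1, 0⟩ else ⟨0, -1⟩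

/-- Twice the lift to characteristic zero of an invertible matrix over `ZMod 3`. -/
def twiceLift (A : Matrix (Fin 2) (Fin 2) (ZMod 3)) : Matrix (Fin 2) (Fin 2) (ℤ√(-2)) :=
  !![liftEntry (A 0 0) (A 0 1) (A 1 0) (A 1 1), liftEntry (A 0 1) (A 0 0) (A 1 1) (A 1 0);
    liftEntry (A 1 0) (A 1 1) (A 0 0) (A 0 1), liftEntry (A 1 1) (A 1 0) (A 0 1) (A 0 0)]

theorem liftEntry_mul_add_mul : ∀ a b c d : ZMod 3, a * d - b * c ≠ 0 →
    ∀ a' b' c' d' : ZMod 3, a' * d' - b' * c' ≠ 0 →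
    liftEntry a b c d * liftEntry a' b' c' d' + liftEntry b a d c * liftEntry c' d' a' b' =
      2 * liftEntry (a * a' + b * c') (a * b' + b * d') (c * a' + d * c') (c * b' + d * d') := by
  decide +kernel

theorem liftEntry_re_add_im : ∀ a b c d : ZMod 3, a * d - b * c ≠ 0 →
    ((liftEntry a b c d).re + (liftEntry a b c d).im : ZMod 3) = 2 * a := by
  decide +kernel

theorem twiceLift_mul {A B : Matrix (Fin 2) (Fin 2) (ZMod 3)} (hA : A.det ≠ 0) (hB : B.det ≠ 0) :
    twiceLift A * twiceLift B = (2 : ℤ√(-2)) • twiceLift (A * B) := by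
  rw [Matrix.det_fin_two] at hA hB
  have hA' : A 1 1 * A 0 0 - A 1 0 * A 0 1 ≠ 0 := by convert hA using 1; ring
  have hA'' : A 1 0 * A 0 1 - A 1 1 * A 0 0 ≠ 0 := by
    rw [← neg_ne_zero]; convert hA using 1; ring
  have hB' : B 0 1 * B 1 0 - B 0 0 * B 1 1 ≠ 0 := by
    rw [← neg_ne_zero]; convert hB using 1; ring
  have h00 := liftEntry_mul_add_mul _ _ _ _ hA _ _ _ _ hB
  have h01 := liftEntry_mul_add_mul _ _ _ _ hA _ _ _ _ hB'
  have h10 := liftEntry_mul_add_mul _ _ _ _ hA'' _ _ _ _ hB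
  have h11 := liftEntry_mul_add_mul _ _ _ _ hA'' _ _ _ _ hB'
  ext i j : 1
  fin_cases i <;> fin_cases j <;>
    simp only [twiceLift, Matrix.mul_apply, Fin.sum_univ_two, Matrix.smul_apply, smul_eq_mul,
      Matrix.of_apply, Matrix.cons_val', Matrix.cons_val_zero, Matrix.cons_val_one, Fin.zero_eta,
      Fin.mk_one, Fin.isValue, Matrix.cons_val_fin_one]
  · exact h00
  · exact h01
  · exact h10
  · exact h11

theorem twiceLift_one : twiceLift 1 = 2 := by
  decide +kernel

/-- Twice the lift reduces to twice the matrix, where `√-2` reduces to `1`. -/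
theorem twiceLift_re_add_im {A : Matrix (Fin 2) (Fin 2) (ZMod 3)} (hA : A.det ≠ 0) (i j : Fin 2) :
    ((twiceLift A i j).re + (twiceLift A i j).im : ZMod 3) = 2 * A i j := by
  rw [Matrix.det_fin_two] at hA
  fin_cases i <;> fin_cases j <;> apply liftEntry_re_add_im <;> intro h <;> apply hA
  · exact h
  · linear_combination -h
  · linear_combination -h
  · linear_combination h

theorem stmt_8 :
    ∃ β : Matrix.GeneralLinearGroup (Fin 2) (ZMod 3) →*
        Matrix.GeneralLinearGroup (Fin 2) ℤ_[3],
      Function.Injective β ∧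
      (Matrix.GeneralLinearGroup.map (PadicInt.toZMod (p := 3))).comp β =
        MonoidHom.id (Matrix.GeneralLinearGroup (Fin 2) (ZMod 3)) := by
  obtain ⟨s, hs, hs1⟩ := exists_sqrt_neg_two_padicInt_three
  obtain ⟨u, hu⟩ : ∃ u : ℤ_[3], 2 * u = 1 :=
    (PadicInt.isUnit_iff.2 PadicInt.norm_two_of_three).exists_right_inv
  have hdet (A : Matrix.GeneralLinearGroup (Fin 2) (ZMod 3)) : A.val.det ≠ 0 :=
    A.det.ne_zero
  let φ : ℤ√(-2) →+* ℤ_[3] := Zsqrtd.lift ⟨s, by simpa using hs⟩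
  let f : Matrix.GeneralLinearGroup (Fin 2) (ZMod 3) →* Matrix (Fin 2) (Fin 2) ℤ_[3] :=
    { toFun A := u • φ.mapMatrix (twiceLift A.val)
      map_one' := by
        rw [Units.val_one, twiceLift_one, map_ofNat, ← Nat.cast_ofNat (R := Matrix _ _ _),
          ← nsmul_one, ← Nat.cast_smul_eq_nsmul ℤ_[3], smul_smul, mul_comm, Nat.cast_ofNat, hu,
          one_smul]
      map_mul' A B := by
        have h2 : φ.mapMatrix ((2 : ℤ√(-2)) • twiceLift (A.val * B.val)) =
            (2 : ℤ_[3]) • φ.mapMatrix (twiceLift (A.val * B.val)) := by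
          ext i j
          simp [map_ofNat φ 2]
        rw [smul_mul_smul_comm, ← map_mul, twiceLift_mul (hdet A) (hdet B), h2, smul_smul,
          Units.val_mul]
        congr 1
        linear_combination (-u) * hu }
  have hf : (Matrix.GeneralLinearGroup.map (PadicInt.toZMod (p := 3))).comp f.toHomUnits =
      MonoidHom.id (Matrix.GeneralLinearGroup (Fin 2) (ZMod 3)) := by
    ext A i j
    have h := twiceLift_re_add_im (hdet A) i j
    have hu' := congrArg (PadicInt.toZMod (p := 3)) hu
    rw [map_mul, map_one, map_ofNat] at hu'
    change PadicInt.toZMod (u * φ (twiceLift A.val i j)) = A.val i j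
    simp only [φ, Zsqrtd.lift_apply_apply, map_mul, map_add, map_intCast, hs1, mul_one]
    linear_combination PadicInt.toZMod u * h + A.val i j * hu'
  have hinv : Function.LeftInverse (Matrix.GeneralLinearGroup.map (PadicInt.toZMod (p := 3)))
      f.toHomUnits := DFunLike.congr_fun hf
  exact ⟨f.toHomUnits, hinv.injective, hf⟩
end

section
/- The splitting β of the reduction map is unique up to conjugation by an element of the congruence kernel: if β₁, β₂ : SL(2, 𝔽₃) → SL(2, ℤ₃) are group homomorphisms with π ∘ β₁ = id and π ∘ β₂ = id, then there exists g ∈ SL(2, ℤ₃) with π(g) = 1 such that β₂(x) = g · β₁(x) · g⁻¹ for all x ∈ SL(2, 𝔽₃). -/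
theorem PadicInt.toZMod_eq_zero_iff_norm_lt_one {p : ℕ} [Fact p.Prime] (x : ℤ_[p]) :
    PadicInt.toZMod x = 0 ↔ ‖x‖ < 1 := by
  rw [← RingHom.mem_ker, PadicInt.ker_toZMod, IsLocalRing.mem_maximalIdeal, PadicInt.mem_nonunits]

theorem PadicInt.isUnit_iff_toZMod_ne_zero {p : ℕ} [Fact p.Prime] (x : ℤ_[p]) :
    IsUnit x ↔ PadicInt.toZMod x ≠ 0 := by
  rw [Ne, PadicInt.toZMod_eq_zero_iff_norm_lt_one, ← PadicInt.mem_nonunits, mem_nonunits_iff,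
    not_not]

theorem PadicInt.exists_sq_eq_of_toZMod_eq_sq {p : ℕ} [Fact p.Prime] (hp : p ≠ 2) {c d : ℤ_[p]}
    (hc : PadicInt.toZMod c ≠ 0) (hd : PadicInt.toZMod d = PadicInt.toZMod c ^ 2) :
    ∃ s : ℤ_[p], s ^ 2 = d ∧ PadicInt.toZMod s = PadicInt.toZMod c := by
  have hder : ‖2 * c‖ = 1 := by
    rw [← PadicInt.isUnit_iff, PadicInt.isUnit_iff_toZMod_ne_zero, map_mul, map_ofNat]
    refine mul_ne_zero ?_ hc
    exact Ring.two_ne_zero (by rwa [ZMod.ringChar_zmod_n])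
  have hval : ‖c ^ 2 - d‖ < 1 := by
    rw [← PadicInt.toZMod_eq_zero_iff_norm_lt_one, map_sub, map_pow, hd, sub_self]
  obtain ⟨s, hs, hsc, -⟩ := hensels_lemma (p := p)
    (F := (Polynomial.X ^ 2 - Polynomial.C d : Polynomial ℤ_[p])) (a := c)
    (by simpa [hder, one_add_one_eq_two] using hval)
  refine ⟨s, by simpa [sub_eq_zero] using hs, ?_⟩
  rw [← sub_eq_zero, ← map_sub, PadicInt.toZMod_eq_zero_iff_norm_lt_one]
  have hF : Polynomial.aeval c (Polynomial.derivative
      (Polynomial.X ^ 2 - Polynomial.C d : Polynomial ℤ_[p])) = 2 * c := by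
    simp [one_add_one_eq_two]
  rwa [hF, hder] at hsc

theorem sum_mul_inv_intertwines {G R : Type*} [Group G] [Fintype G] [CommRing R] {n : Type*}
    [Fintype n] [DecidableEq n] (f₁ f₂ : G →* Matrix.SpecialLinearGroup n R) (q : G) :
    (f₂ q : Matrix n n R) * ∑ x, (f₂ x * (f₁ x)⁻¹ : Matrix.SpecialLinearGroup n R).1 =
      (∑ x, (f₂ x * (f₁ x)⁻¹ : Matrix.SpecialLinearGroup n R).1) * (f₁ q : Matrix n n R) := by
  rw [Finset.mul_sum, Finset.sum_mul, ← Equiv.sum_comp (Equiv.mulLeft q)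
    fun x => (f₂ x * (f₁ x)⁻¹ : Matrix.SpecialLinearGroup n R).1 * (f₁ q : Matrix n n R)]
  refine Finset.sum_congr rfl fun x _ => ?_
  rw [← Matrix.SpecialLinearGroup.coe_mul, ← Matrix.SpecialLinearGroup.coe_mul]
  congr 1
  simp only [Equiv.coe_mulLeft, map_mul, mul_inv_rev, mul_assoc, inv_mul_cancel, mul_one]
  rfl

theorem exists_conj_of_map_toZMod_eq {p : ℕ} [Fact p.Prime] (hp : p ≠ 2) {G : Type*} [Group G]
    [Fintype G] (hG : (Fintype.card G : ZMod p) ≠ 0)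
    (f₁ f₂ : G →* Matrix.SpecialLinearGroup (Fin 2) ℤ_[p])
    (h : ∀ x, Matrix.SpecialLinearGroup.map (PadicInt.toZMod (p := p)) (f₁ x) =
      Matrix.SpecialLinearGroup.map (PadicInt.toZMod (p := p)) (f₂ x)) :
    ∃ g : Matrix.SpecialLinearGroup (Fin 2) ℤ_[p],
      Matrix.SpecialLinearGroup.map (PadicInt.toZMod (p := p)) g = 1 ∧
      ∀ x, f₂ x = g * f₁ x * g⁻¹ := by
  set H : Matrix (Fin 2) (Fin 2) ℤ_[p] :=
    ∑ x, (f₂ x * (f₁ x)⁻¹ : Matrix.SpecialLinearGroup (Fin 2) ℤ_[p]).1 with hH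
  have hHmap : (PadicInt.toZMod (p := p)).mapMatrix H =
      (Fintype.card G : ZMod p) • (1 : Matrix (Fin 2) (Fin 2) (ZMod p)) := by
    have key (x : G) : (PadicInt.toZMod (p := p)).mapMatrix
        (f₂ x * (f₁ x)⁻¹ : Matrix.SpecialLinearGroup (Fin 2) ℤ_[p]).1 = 1 := by
      rw [← Matrix.SpecialLinearGroup.map_apply_coe, map_mul, map_inv, h, mul_inv_cancel,
        Matrix.SpecialLinearGroup.coe_one]
    rw [hH, map_sum, Finset.sum_congr rfl fun x _ => key x]
    simp [Nat.cast_smul_eq_nsmul]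
  have hdet : PadicInt.toZMod H.det = PadicInt.toZMod (Fintype.card G : ℤ_[p]) ^ 2 := by
    rw [RingHom.map_det, hHmap, Matrix.det_smul]
    simp
  obtain ⟨s, hs, hsc⟩ := PadicInt.exists_sq_eq_of_toZMod_eq_sq hp (by simpa using hG) hdet
  rw [map_natCast] at hsc
  obtain ⟨t, ht⟩ := ((PadicInt.isUnit_iff_toZMod_ne_zero s).2 (hsc ▸ hG)).exists_left_inv
  let g : Matrix.SpecialLinearGroup (Fin 2) ℤ_[p] := ⟨t • H, by
    rw [Matrix.det_smul, ← hs, Fintype.card_fin, ← mul_pow, ht, one_pow]⟩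
  refine ⟨g, ?_, fun x => ?_⟩
  · apply Subtype.ext
    rw [Matrix.SpecialLinearGroup.map_apply_coe]
    change (PadicInt.toZMod (p := p)).mapMatrix (t • H) = 1
    have : (PadicInt.toZMod (p := p)).mapMatrix (t • H) =
        PadicInt.toZMod t • (PadicInt.toZMod (p := p)).mapMatrix H := by
      ext i j
      simp
    rw [this, hHmap, smul_smul, ← hsc, ← map_mul, ht, map_one, one_smul]
  · rw [eq_mul_inv_iff_mul_eq]
    apply Subtype.ext
    change (f₂ x).1 * (t • H) = (t • H) * (f₁ x).1
    rw [Matrix.mul_smul, Matrix.smul_mul, hH, sum_mul_inv_intertwines]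

/-- The normal quaternion subgroup of `SL(2, 𝔽₃)`. -/
def quaternionSubgroup : Subgroup (Matrix.SpecialLinearGroup (Fin 2) (ZMod 3)) where
  carrier := {x | x ^ 4 = 1}
  mul_mem' {x y} hx hy := by
    have key : ∀ x y : Matrix.SpecialLinearGroup (Fin 2) (ZMod 3),
        x ^ 4 = 1 → y ^ 4 = 1 → (x * y) ^ 4 = 1 := by decide +kernel
    exact key x y hx hy
  one_mem' := one_pow 4
  inv_mem' {x} hx := by simpa using hx

theorem mem_quaternionSubgroup {x : Matrix.SpecialLinearGroup (Fin 2) (ZMod 3)} :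
    x ∈ quaternionSubgroup ↔ x ^ 4 = 1 := Iff.rfl

instance : DecidablePred (· ∈ quaternionSubgroup) :=
  fun x => decidable_of_iff (x ^ 4 = 1) mem_quaternionSubgroup.symm

theorem card_quaternionSubgroup : Fintype.card quaternionSubgroup = 8 := by
  decide +kernel

instance : quaternionSubgroup.Normal where
  conj_mem x hx g := by
    rw [mem_quaternionSubgroup] at hx ⊢
    simp [conj_pow, hx]

theorem eq_one_of_commute_quaternion_lifts {A B z : Matrix.SpecialLinearGroup (Fin 2) ℤ_[3]}
    (hA : (Matrix.SpecialLinearGroup.map (PadicInt.toZMod (p := 3)) A).1 = !![0, -1; 1, 0])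
    (hB : (Matrix.SpecialLinearGroup.map (PadicInt.toZMod (p := 3)) B).1 = !![1, 1; 1, -1])
    (hz : Matrix.SpecialLinearGroup.map (PadicInt.toZMod (p := 3)) z = 1)
    (hzA : Commute A z) (hzB : Commute B z) : z = 1 := by
  have hz' := congrArg Subtype.val hz
  have hAz := congrArg Subtype.val hzA.eq
  have hBz := congrArg Subtype.val hzB.eq
  rw [Matrix.SpecialLinearGroup.map_apply_coe] at hA hB hz'
  have hdet := z.2
  have entry {M : Matrix (Fin 2) (Fin 2) ℤ_[3]} {N : Matrix (Fin 2) (Fin 2) (ZMod 3)}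
      (h : (PadicInt.toZMod (p := 3)).mapMatrix M = N) (i j : Fin 2) :
      PadicInt.toZMod (M i j) = N i j := by
    rw [← h]; rfl
  have a00 := entry hA 0 0
  have a01 := entry hA 0 1
  have a10 := entry hA 1 0
  have a11 := entry hA 1 1
  have b00 := entry hB 0 0
  have b01 := entry hB 0 1
  have b11 := entry hB 1 1
  have z00 := entry hz' 0 0
  have eA00 := congrFun (congrFun hAz 0) 0
  have eA01 := congrFun (congrFun hAz 0) 1
  have eB01 := congrFun (congrFun hBz 0) 1
  simp only [Matrix.SpecialLinearGroup.coe_mul, Matrix.mul_apply, Fin.sum_univ_two]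
    at eA00 eA01 eB01
  rw [Matrix.det_fin_two] at hdet
  simp at a00 a01 a10 a11 b00 b01 b11 z00
  have ne_zero_of {x : ℤ_[3]} (h : PadicInt.toZMod x ≠ 0) : x ≠ 0 := fun hx => h (by simp [hx])
  have hb : z.1 0 1 = 0 := by
    have hne : B.1 0 1 * (A.1 0 0 - A.1 1 1) - A.1 0 1 * (B.1 0 0 - B.1 1 1) ≠ 0 := by
      apply ne_zero_of
      simp only [map_sub, map_mul, a00, a01, a11, b00, b01, b11]
      decide
    refine (mul_eq_zero.1 ?_).resolve_left hne
    linear_combination B.1 0 1 * eA01 - A.1 0 1 * eB01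
  have hc : z.1 1 0 = 0 := by
    have hne : A.1 0 1 ≠ 0 := ne_zero_of (by rw [a01]; decide)
    refine (mul_eq_zero.1 ?_).resolve_left hne
    linear_combination eA00 + A.1 1 0 * hb
  have had : z.1 0 0 = z.1 1 1 := by
    have hne : A.1 0 1 ≠ 0 := ne_zero_of (by rw [a01]; decide)
    refine mul_left_cancel₀ hne ?_
    linear_combination -eA01 + (A.1 0 0 - A.1 1 1) * hb
  have ha : z.1 0 0 = 1 := by
    have hne : z.1 0 0 + 1 ≠ 0 := ne_zero_of (by rw [map_add, z00, map_one]; decide)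
    refine sub_eq_zero.1 ((mul_eq_zero.1 ?_).resolve_left hne)
    linear_combination hdet + z.1 0 0 * had + z.1 1 0 * hb
  ext i j
  fin_cases i <;> fin_cases j
  · exact ha
  · exact hb
  · exact hc
  · exact had.symm.trans ha

theorem MonoidHom.commute_mul_inv_of_eq_on_normal {G H : Type*} [Group G] [Group H]
    {N : Subgroup G} [hN : N.Normal] {f₁ f₂ : G →* H} (h : ∀ q ∈ N, f₁ q = f₂ q) {q : G}
    (hq : q ∈ N) (x : G) : Commute (f₂ q) (f₂ x * (f₁ x)⁻¹) := by
  have hconj := h _ (hN.conj_mem' q hq x)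
  simp only [map_mul, map_inv, h q hq] at hconj
  calc f₂ q * (f₂ x * (f₁ x)⁻¹)
      = f₂ x * ((f₂ x)⁻¹ * f₂ q * f₂ x) * (f₁ x)⁻¹ := by group
    _ = f₂ x * (f₁ x)⁻¹ * f₂ q := by rw [← hconj]; group

theorem stmt_9
    (β₁ β₂ : Matrix.SpecialLinearGroup (Fin 2) (ZMod 3) →*
      Matrix.SpecialLinearGroup (Fin 2) ℤ_[3])
    (h₁ : (Matrix.SpecialLinearGroup.map (PadicInt.toZMod (p := 3))).comp β₁ =
      MonoidHom.id (Matrix.SpecialLinearGroup (Fin 2) (ZMod 3)))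
    (h₂ : (Matrix.SpecialLinearGroup.map (PadicInt.toZMod (p := 3))).comp β₂ =
      MonoidHom.id (Matrix.SpecialLinearGroup (Fin 2) (ZMod 3))) :
    ∃ g : Matrix.SpecialLinearGroup (Fin 2) ℤ_[3],
      Matrix.SpecialLinearGroup.map (PadicInt.toZMod (p := 3)) g = 1 ∧
      ∀ x, β₂ x = g * β₁ x * g⁻¹ := by
  replace h₁ := DFunLike.congr_fun h₁
  replace h₂ := DFunLike.congr_fun h₂
  simp only [MonoidHom.comp_apply, MonoidHom.id_apply] at h₁ h₂
  obtain ⟨g, hg, hconj⟩ := exists_conj_of_map_toZMod_eq (by norm_num)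
    (by rw [card_quaternionSubgroup]; decide) (β₁.comp quaternionSubgroup.subtype)
    (β₂.comp quaternionSubgroup.subtype) fun x => by simp [h₁, h₂]
  refine ⟨g, hg, fun x => ?_⟩
  let γ := (MulAut.conj g).toMonoidHom.comp β₁
  have hγ : ∀ q ∈ quaternionSubgroup, γ q = β₂ q := fun q hq => (hconj ⟨q, hq⟩).symm
  let i : Matrix.SpecialLinearGroup (Fin 2) (ZMod 3) := ⟨!![0, -1; 1, 0], by decide⟩
  let j : Matrix.SpecialLinearGroup (Fin 2) (ZMod 3) := ⟨!![1, 1; 1, -1], by decide⟩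
  have hi : i ∈ quaternionSubgroup := mem_quaternionSubgroup.2 (by decide +kernel)
  have hj : j ∈ quaternionSubgroup := mem_quaternionSubgroup.2 (by decide +kernel)
  have hz : β₂ x * (γ x)⁻¹ = 1 := by
    refine eq_one_of_commute_quaternion_lifts (A := β₂ i) (B := β₂ j) ?_ ?_ ?_
      (MonoidHom.commute_mul_inv_of_eq_on_normal hγ hi x)
      (MonoidHom.commute_mul_inv_of_eq_on_normal hγ hj x)
    · rw [h₂]
    · rw [h₂]
    · simp [γ, h₁, h₂, hg]
  exact mul_inv_eq_one.1 hz
end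

section
/- Let G be a nonabelian group of order 12 in which the Sylow 2-subgroup is normal (equivalently, G has a unique Sylow 2-subgroup). Then G is isomorphic to the alternating group A₄. -/
/-- A group with two disjoint normal subgroups whose quotients are commutative is commutative. -/
theorem mul_comm_of_disjoint_of_quotient_comm {G : Type*} [Group G] {H K : Subgroup G}
    [H.Normal] [K.Normal] (hHK : Disjoint H K) (hH : IsMulCommutative (G ⧸ H))
    (hK : IsMulCommutative (G ⧸ K)) (a b : G) : a * b = b * a := by
  have mem (N : Subgroup G) [N.Normal] (hN : IsMulCommutative (G ⧸ N)) :
      (a * b)⁻¹ * (b * a) ∈ N :=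
    QuotientGroup.eq.mp (mul_comm' (a : G ⧸ N) (b : G ⧸ N))
  exact inv_mul_eq_one.mp (Subgroup.disjoint_def.mp hHK (mem H hH) (mem K hK))

/-- A group of order 12 acts on the cosets of a non-normal subgroup of order 3 as the alternating
group. -/
theorem nonempty_mulEquiv_alternatingGroup_of_not_normal {G : Type*} [Group G]
    (hG : Nat.card G = 12) {Q : Subgroup G} (hQ : Nat.card Q = 3) (hn : ¬ Q.Normal) :
    Nonempty (G ≃* alternatingGroup (Fin 4)) := by
  have : Finite G := Nat.finite_of_card_ne_zero (by omega)
  have hindex : Nat.card (G ⧸ Q) = 4 := by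
    have := Q.card_mul_index
    rw [hQ, hG, Subgroup.index] at this
    omega
  have hcore : Q.normalCore = ⊥ := by
    have hdvd := Subgroup.card_dvd_of_le Q.normalCore_le
    rw [hQ, Nat.dvd_prime Nat.prime_three] at hdvd
    rcases hdvd with h | h
    · exact Subgroup.card_eq_one.mp h
    · exact absurd (Subgroup.eq_of_le_of_card_ge Q.normalCore_le (by rw [h, hQ]) ▸
        Q.normalCore_normal) hn
  let f : G →* Equiv.Perm (Fin 4) :=
    (Finite.equivFinOfCardEq hindex).permCongrHom.toMonoidHom.comp (MulAction.toPermHom G (G ⧸ Q))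
  have hf : Function.Injective f :=
    (Finite.equivFinOfCardEq hindex).permCongrHom.injective.comp
      ((MonoidHom.ker_eq_bot_iff _).mp (Q.normalCore_eq_ker.symm.trans hcore))
  let e := MonoidHom.ofInjective hf
  have hrange : f.range = alternatingGroup (Fin 4) := by
    apply Equiv.Perm.eq_alternatingGroup_of_index_eq_two
    have := f.range.card_mul_index
    rw [← Nat.card_congr e.toEquiv, hG, Nat.card_perm, Nat.card_fin] at this
    simp only [Nat.factorial] at this
    omega
  exact ⟨e.trans (MulEquiv.subgroupCongr hrange)⟩

theorem stmt_10 (G : Type*) [Group G] [Fintype G] (hcard : Fintype.card G = 12)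
    (hnonab : ∃ a b : G, a * b ≠ b * a)
    (hnormal : ∀ P : Sylow 2 G, (P : Subgroup G).Normal) :
    Nonempty (G ≃* alternatingGroup (Fin 4)) := by
  have hG : Nat.card G = 12 := Nat.card_eq_fintype_card.trans hcard
  have : Fact (Nat.Prime 3) := ⟨Nat.prime_three⟩
  obtain ⟨P, hP⟩ := Sylow.exists_subgroup_card_pow_prime 2 (n := 2) (G := G) (by rw [hG]; norm_num)
  obtain ⟨Q, hQ⟩ := Sylow.exists_subgroup_card_pow_prime 3 (n := 1) (G := G) (by rw [hG]; norm_num)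
  have hPindex : P.index = 3 := by
    have := P.card_mul_index
    rw [hP, hG] at this
    omega
  have hQindex : Q.index = 2 ^ 2 := by
    have := Q.card_mul_index
    rw [hQ, hG] at this
    omega
  have hPn : P.Normal := hnormal ((IsPGroup.of_card hP).toSylow (by rw [hPindex]; norm_num))
  refine nonempty_mulEquiv_alternatingGroup_of_not_normal hG hQ fun hQn ↦ ?_
  obtain ⟨a, b, hab⟩ := hnonab
  have hdisj : Disjoint P Q :=
    Subgroup.disjoint_of_coprime_natCard (by rw [hP, hQ]; norm_num)
  exact hab (mul_comm_of_disjoint_of_quotient_comm hdisj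
    (isCyclic_of_prime_card (p := 3) hPindex).isMulCommutative
    (IsPGroup.isMulCommutative_of_card_eq_prime_sq hQindex) a b)
end

section
/- Let G be a group of order 24 containing a normal subgroup N with N isomorphic to the alternating group A₄. Then G is isomorphic to A₄ × ℤ/2ℤ or G is isomorphic to the symmetric group S₄. -/
/-- The three-cycle `(0 1 2)`, as an element of `A₄`. -/
def threeCycleA4 : alternatingGroup (Fin 4) :=
  ⟨Equiv.swap 0 1 * Equiv.swap 1 2, Equiv.Perm.mem_alternatingGroup.mpr (by decide)⟩

/-- The double transposition `(0 1)(2 3)`, as an element of `A₄`. -/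
def doubleSwapA4 : alternatingGroup (Fin 4) :=
  ⟨Equiv.swap 0 1 * Equiv.swap 2 3, Equiv.Perm.mem_alternatingGroup.mpr (by decide)⟩

set_option maxRecDepth 10000 in
theorem exists_eq_threeCycleA4_mul_doubleSwapA4_mul (g : alternatingGroup (Fin 4)) :
    ∃ i j k : Fin 3,
      g = threeCycleA4 ^ i.val * doubleSwapA4 ^ j.val * threeCycleA4 ^ k.val := by
  revert g
  decide

set_option maxRecDepth 10000 in
theorem exists_perm_conj_eq (x y : alternatingGroup (Fin 4))
    (hx : x ^ 3 = 1) (hx1 : x ≠ 1) (hy : y ^ 2 = 1) (hy1 : y ≠ 1) :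
    ∃ σ : Equiv.Perm (Fin 4),
      MulAut.conjNormal σ threeCycleA4 = x ∧ MulAut.conjNormal σ doubleSwapA4 = y := by
  revert x y
  decide

set_option maxRecDepth 10000 in
theorem eq_one_of_conjNormal_A4_fixes (σ : Equiv.Perm (Fin 4))
    (ha : MulAut.conjNormal σ threeCycleA4 = threeCycleA4)
    (hb : MulAut.conjNormal σ doubleSwapA4 = doubleSwapA4) : σ = 1 := by
  revert σ
  decide

/-- Every automorphism of `A₄` is conjugation by a unique element of `S₄`. -/
theorem conjNormal_A4_bijective :
    Function.Bijective
      (MulAut.conjNormal : Equiv.Perm (Fin 4) →* MulAut (alternatingGroup (Fin 4))) := by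
  constructor
  · rw [injective_iff_map_eq_one]
    intro σ hσ
    apply eq_one_of_conjNormal_A4_fixes <;> simp [hσ]
  · intro f
    obtain ⟨σ, ha, hb⟩ := exists_perm_conj_eq (f threeCycleA4) (f doubleSwapA4)
      (by rw [← map_pow, show threeCycleA4 ^ 3 = 1 by decide, map_one])
      (by rw [Ne, map_eq_one_iff f f.injective]; decide)
      (by rw [← map_pow, show doubleSwapA4 ^ 2 = 1 by decide, map_one])
      (by rw [Ne, map_eq_one_iff f f.injective]; decide)
    refine ⟨σ, MulEquiv.ext fun g ↦ ?_⟩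
    obtain ⟨i, j, k, rfl⟩ := exists_eq_threeCycleA4_mul_doubleSwapA4_mul g
    simp only [map_mul, map_pow, ha, hb]

/-- A group of order `2 * |N|` whose subgroup `N` is centreless and has nontrivial centralizer is
the direct product of `N` and a group of order two. -/
theorem nonempty_mulEquiv_prod_of_centralizer_ne_bot {G : Type*} [Group G] [Finite G]
    (N : Subgroup G) (hcard : Nat.card G = 2 * Nat.card N) (hcenter : Subgroup.center N = ⊥)
    (hC : Subgroup.centralizer (N : Set G) ≠ ⊥) :
    Nonempty (G ≃* N × Multiplicative (ZMod 2)) := by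
  set C := Subgroup.centralizer (N : Set G)
  have hdisj : Disjoint N C := by
    rw [Subgroup.disjoint_def]
    intro x hxN hxC
    have hx : (⟨x, hxN⟩ : N) ∈ Subgroup.center N :=
      Subgroup.mem_center_iff.mpr fun g ↦ Subtype.ext (hxC g g.2)
    rw [hcenter, Subgroup.mem_bot] at hx
    exact congrArg Subtype.val hx
  let φ : N × C →* G := N.subtype.noncommCoprod C.subtype fun n c ↦ c.2 n n.2
  have hφ : Function.Injective φ := by
    refine MonoidHom.noncommCoprod_injective _ _ _ |>.mpr
      ⟨N.subtype_injective, C.subtype_injective, ?_⟩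
    simpa using hdisj
  have hle := Nat.card_le_card_of_injective φ hφ
  rw [Nat.card_prod, hcard, mul_comm 2] at hle
  have hC2 : Nat.card C = 2 :=
    le_antisymm (Nat.le_of_mul_le_mul_left hle Nat.card_pos)
      ((Subgroup.one_lt_card_iff_ne_bot C).mpr hC)
  have hbij : Function.Bijective φ := by
    refine (Nat.bijective_iff_injective_and_card φ).mpr ⟨hφ, ?_⟩
    rw [Nat.card_prod, hC2, hcard, mul_comm]
  have : Fact (Nat.Prime 2) := ⟨Nat.prime_two⟩
  exact ⟨(MulEquiv.ofBijective φ hbij).symm.trans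
    ((MulEquiv.refl N).prodCongr (mulEquivOfPrimeCardEq (p := 2) hC2 (by simp)))⟩

theorem stmt_11 (G : Type*) [Group G] [Fintype G] (hcard : Fintype.card G = 24)
    (N : Subgroup G) (hN : N.Normal)
    (hiso : Nonempty (N ≃* alternatingGroup (Fin 4))) :
    Nonempty (G ≃* (alternatingGroup (Fin 4) × Multiplicative (ZMod 2))) ∨
    Nonempty (G ≃* Equiv.Perm (Fin 4)) := by
  obtain ⟨e⟩ := hiso
  rw [← Nat.card_eq_fintype_card] at hcard
  by_cases hC : Subgroup.centralizer (N : Set G) = ⊥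
  · right
    let ε : MulAut N ≃* Equiv.Perm (Fin 4) :=
      (MulAut.congr e).trans (MulEquiv.ofBijective _ conjNormal_A4_bijective).symm
    let ψ : G →* Equiv.Perm (Fin 4) := ε.toMonoidHom.comp MulAut.conjNormal
    have hψ : Function.Injective ψ := by
      refine ε.injective.comp ?_
      rw [injective_iff_map_eq_one]
      intro g hg
      rw [← Subgroup.mem_bot, ← hC, Subgroup.mem_centralizer_iff]
      intro n hn
      have h := congrArg Subtype.val (DFunLike.congr_fun hg ⟨n, hn⟩)
      rw [MulAut.conjNormal_apply, MulAut.one_apply, mul_inv_eq_iff_eq_mul] at h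
      exact h.symm
    refine ⟨MulEquiv.ofBijective ψ ((Nat.bijective_iff_injective_and_card ψ).mpr ⟨hψ, ?_⟩)⟩
    rw [hcard, Nat.card_perm, Nat.card_fin]
    rfl
  · left
    have hcardN : Nat.card N = 12 := by
      rw [Nat.card_congr e.toEquiv, nat_card_alternatingGroup, Nat.card_fin]
      rfl
    have hcenter : Subgroup.center N = ⊥ := by
      have h := alternatingGroup.center_eq_bot (α := Fin 4) (by simp)
      rw [← Subgroup.card_eq_one] at h ⊢
      rw [Nat.card_congr (Subgroup.centerCongr e).toEquiv, h]
    obtain ⟨f⟩ := nonempty_mulEquiv_prod_of_centralizer_ne_bot N (by omega) hcenter hC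
    exact ⟨f.trans (e.prodCongr (MulEquiv.refl _))⟩
end

section
/- Let F be a finite field with q elements, G a group, and V a nonzero finite-dimensional F-vector space with an F-linear G-action making V a simple (irreducible) F[G]-module, and assume that every G-equivariant F-linear endomorphism of V is multiplication by a scalar in F. Then for every integer k ≥ 1, the number of nonzero simple F[G]-submodules of the direct sum V^{⊕k} equals the cardinality of the projective space ℙ(F^k), namely (q^k − 1)/(q − 1). -/
section DiagonalEmbedding

variable {F : Type*} [Field F] {A : Type*} [Ring A] [Algebra F A]
  (M : Type*) [AddCommGroup M] [Module F M] [Module A M] [IsScalarTower F A M]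
  {ι : Type*}

/-- The `A`-linear map `M → M^ι` sending `m` to `(a i • m)ᵢ`. -/
def smulPi (a : ι → F) : M →ₗ[A] ι → M where
  toFun m i := a i • m
  map_add' m m' := by ext i; simp
  map_smul' r m := by
    ext i
    have := IsScalarTower.to_smulCommClass' (R := F) (A := A) (M := M)
    exact smul_comm (a i) r m

@[simp]
theorem smulPi_apply (a : ι → F) (m : M) (i : ι) : smulPi (A := A) M a m i = a i • m := rfl

theorem smulPi_injective {a : ι → F} (ha : a ≠ 0) :
    Function.Injective (smulPi (A := A) M a) := by
  obtain ⟨i, hi⟩ := Function.ne_iff.mp ha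
  intro m m' h
  exact (smul_right_inj hi).mp (congrFun h i)

theorem range_smulPi_smul_le (c : F) (a : ι → F) :
    LinearMap.range (smulPi (A := A) M (c • a)) ≤ LinearMap.range (smulPi (A := A) M a) := by
  rintro _ ⟨m, rfl⟩
  exact ⟨c • m, by ext i; simp [smul_smul, mul_comm]⟩

theorem isSimpleModule_range_smulPi [IsSimpleModule A M] {a : ι → F} (ha : a ≠ 0) :
    IsSimpleModule A (LinearMap.range (smulPi (A := A) M a)) :=
  IsSimpleModule.congr (LinearEquiv.ofInjective _ (smulPi_injective M ha)).symm

theorem exists_smul_eq_of_range_smulPi_le [Nontrivial M] {a b : ι → F} (hb : b ≠ 0)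
    (h : LinearMap.range (smulPi (A := A) M a) ≤ LinearMap.range (smulPi (A := A) M b)) :
    ∃ c : F, c • b = a := by
  obtain ⟨j, hj⟩ := Function.ne_iff.mp hb
  obtain ⟨m, hm⟩ := exists_ne (0 : M)
  obtain ⟨m', hm'⟩ := h ⟨m, rfl⟩
  have key (i : ι) : b j * a i = b i * a j := by
    refine smul_left_injective F hm ?_
    have hi : b i • m' = a i • m := congrFun hm' i
    have hj : b j • m' = a j • m := congrFun hm' j
    simp only [mul_smul, ← hi, ← hj]
    exact smul_comm _ _ _
  refine ⟨a j / b j, funext fun i => ?_⟩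
  have hj : b j ≠ 0 := hj
  simp only [Pi.smul_apply, smul_eq_mul]
  field_simp
  linear_combination -key i

theorem exists_range_smulPi_eq [IsSimpleModule A M]
    (hend : ∀ φ : M →ₗ[A] M, ∃ c : F, ∀ m : M, φ m = c • m)
    (W : Submodule A (ι → M)) [IsSimpleModule A W] :
    ∃ a : ι → F, a ≠ 0 ∧ LinearMap.range (smulPi (A := A) M a) = W := by
  have hW := IsSimpleModule.nontrivial A W
  obtain ⟨w, hw⟩ := exists_ne (0 : W)
  obtain ⟨j, hj⟩ : ∃ j, (w : ι → M) j ≠ 0 :=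
    Function.ne_iff.mp fun h => hw (Subtype.ext h)
  let p (i : ι) : W →ₗ[A] M := LinearMap.proj i ∘ₗ W.subtype
  have hp : Function.Bijective (p j) :=
    LinearMap.bijective_of_ne_zero fun h => hj (LinearMap.congr_fun h w)
  let e := LinearEquiv.ofBijective (p j) hp
  choose a ha using fun i => hend (p i ∘ₗ e.symm.toLinearMap)
  have hrange : LinearMap.range (smulPi (A := A) M a) = W := by
    have heq : smulPi (A := A) M a = W.subtype ∘ₗ e.symm.toLinearMap := by
      ext m i
      exact (ha i m).symm
    rw [heq, LinearMap.range_comp, LinearEquiv.range, Submodule.map_top, Submodule.range_subtype]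
  refine ⟨a, ?_, hrange⟩
  rintro rfl
  obtain ⟨m, hm⟩ := hrange.ge w.2
  exact hj (by rw [← hm]; simp)

/-- If `M` is a simple `A`-module whose only endomorphisms are the scalars in `F`, then the simple
submodules of `M^ι` correspond to the lines in `F^ι`. -/
noncomputable def projectivizationEquivSimpleSubmodules [IsSimpleModule A M]
    (hend : ∀ φ : M →ₗ[A] M, ∃ c : F, ∀ m : M, φ m = c • m) :
    Projectivization F (ι → F) ≃
      {W : Submodule A (ι → M) // W ≠ ⊥ ∧ IsSimpleModule A W} := by
  have := IsSimpleModule.nontrivial A M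
  refine Equiv.ofBijective (fun x => ⟨LinearMap.range (smulPi (A := A) M x.rep), ?_, ?_⟩) ⟨?_, ?_⟩
  · have := isSimpleModule_range_smulPi (A := A) M x.rep_nonzero
    exact (Submodule.nontrivial_iff_ne_bot).mp (IsSimpleModule.nontrivial A _)
  · exact isSimpleModule_range_smulPi M x.rep_nonzero
  · intro x y hxy
    rw [← x.mk_rep, ← y.mk_rep, Projectivization.mk_eq_mk_iff']
    exact exists_smul_eq_of_range_smulPi_le M y.rep_nonzero (Subtype.ext_iff.mp hxy).le
  · rintro ⟨W, _, hW⟩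
    obtain ⟨a, ha, rfl⟩ := exists_range_smulPi_eq M hend W
    refine ⟨Projectivization.mk F a ha, Subtype.ext (le_antisymm ?_ ?_)⟩
    · obtain ⟨c, hc⟩ := Projectivization.exists_smul_eq_mk_rep F a ha
      simp only [← hc]
      exact range_smulPi_smul_le M (c : F) a
    · obtain ⟨c, hc⟩ := (Projectivization.mk_eq_mk_iff' F a _ ha
        (Projectivization.rep_nonzero _)).mp (Projectivization.mk_rep _).symm
      have hle := range_smulPi_smul_le (A := A) M c (Projectivization.mk F a ha).rep
      rwa [hc] at hle

end DiagonalEmbedding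


theorem stmt_13 (F : Type*) [Field F] [Fintype F] (q : ℕ) (hq : Fintype.card F = q)
    (G : Type*) [Group G]
    (V : Type*) [AddCommGroup V] [Nontrivial V] [Module F V]
    [Module (MonoidAlgebra F G) V] [IsScalarTower F (MonoidAlgebra F G) V]
    [FiniteDimensional F V]
    (hsimple : IsSimpleModule (MonoidAlgebra F G) V)
    (hSchur : ∀ φ : V →ₗ[MonoidAlgebra F G] V, ∃ c : F, ∀ v : V, φ v = c • v)
    (k : ℕ) (hk : 1 ≤ k) :
    Nat.card {W : Submodule (MonoidAlgebra F G) (Fin k → V) //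
        W ≠ ⊥ ∧ IsSimpleModule (MonoidAlgebra F G) W} =
      Nat.card (Projectivization F (Fin k → F)) ∧
    Nat.card {W : Submodule (MonoidAlgebra F G) (Fin k → V) //
        W ≠ ⊥ ∧ IsSimpleModule (MonoidAlgebra F G) W} = (q ^ k - 1) / (q - 1) := by
  have hcard := Nat.card_congr (projectivizationEquivSimpleSubmodules (ι := Fin k) V hSchur)
  refine ⟨hcard.symm, ?_⟩
  rw [← hcard, Projectivization.card'']
  simp [hq]
end
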